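/- Let X be a nonempty set and let Φ be a mapping with domain X². Then the following four conditions are equivalent: (i) there is a totally ordered set Q (with smallest element) such that Φ is combinatorially similar to a Q-ultrametric; (ii) there is a poset Q (with smallest element) such that Φ is combinatorially similar to a Q-ultrametric; (iii) Φ is symmetric, the transitive closure u_Φᵗ of u_Φ is antisymmetric, Φ⁻¹(a₀) = Δ_X holds for some a₀ ∈ Φ(X²), and for every triple ⟨x₁,x₂,x₃⟩ of points of X there is a permutation ⟨x_{i₁},x_{i₂},x_{i₃}⟩ of it such that Φ(x_{i₁},x_{i₂}) = Φ(x_{i₂},x_{i₃}); (iv) there is b₀ ∈ Φ(X²) such that Φ⁻¹(b₀) = Δ_X, the binary relation ≼_Φ := u_Φᵗ ∪ Δ_{Φ(X²)} is a partial order on Φ(X²), b₀ is the smallest element of (Φ(X²), ≼_Φ), and Φ is a ≼_Φ-ultrametric on X. -/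

import Mathlib

namespace CombSimPaper

/-- The range `Φ(X²)` of a mapping `Φ` with domain `X²`. -/
def rng {X A : Type*} (Φ : X → X → A) : Set A := {a | ∃ x y, Φ x y = a}

/-- `Φ` is strongly consistent with the binary relation `R` on `X`. -/
def StronglyConsistent {X A : Type*} (Φ : X → X → A) (R : X → X → Prop) : Prop :=
  ∀ x₁ x₂ x₃ x₄, R x₁ x₂ → R x₃ x₄ → Φ x₁ x₃ = Φ x₂ x₄

/-- The fiber `Φ⁻¹(a)`, viewed as a binary relation on `X`. -/
def fiber {X A : Type*} (Φ : X → X → A) (a : A) : X → X → Prop :=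
  fun x y => Φ x y = a

/-- `Φ` is `a₀`-coherent: the fiber `Φ⁻¹(a₀)` is an equivalence relation and `Φ` is
strongly consistent with it. -/
def Coherent {X A : Type*} (Φ : X → X → A) (a₀ : A) : Prop :=
  Equivalence (fiber Φ a₀) ∧ StronglyConsistent Φ (fiber Φ a₀)

/-- `g : Y → X` is a combinatorial similarity for the mappings `Ψ` (with domain `Y²`)
and `Φ` (with domain `X²`). -/
def CombSimWith {X Y A B : Type*} (Φ : X → X → A) (Ψ : Y → Y → B) (g : Y → X) : Prop :=
  Function.Bijective g ∧ ∃ f : A → B, Set.BijOn f (rng Φ) (rng Ψ) ∧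
    ∀ x y : Y, Ψ x y = f (Φ (g x) (g y))

/-- `Φ` is combinatorially similar to `Ψ`. -/
def CombSim {X Y A B : Type*} (Φ : X → X → A) (Ψ : Y → Y → B) : Prop :=
  ∃ g : Y → X, CombSimWith Φ Ψ g

/-- Some permutation `⟨x_{i₁}, x_{i₂}, x_{i₃}⟩` of the triple `⟨x₁, x₂, x₃⟩`
satisfies the ternary predicate `P`. -/
def PermTriple {X : Type*} (P : X → X → X → Prop) (x₁ x₂ x₃ : X) : Prop :=
  ∃ σ : Equiv.Perm (Fin 3),
    P (![x₁, x₂, x₃] (σ 0)) (![x₁, x₂, x₃] (σ 1)) (![x₁, x₂, x₃] (σ 2))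

/-- `d : X² → Q` is a `≼`-pseudoultrametric (for the order `le` with smallest element `q₀`). -/
def QPseudoUltra {X Q : Type*} (le : Q → Q → Prop) (q₀ : Q) (d : X → X → Q) : Prop :=
  (∀ x y, d x y = d y x) ∧ (∀ x, d x x = q₀) ∧
  ∀ x₁ x₂ x₃, PermTriple (fun a b c => le (d a c) (d a b) ∧ d a b = d b c) x₁ x₂ x₃

/-- `d : X² → Q` is a `≼`-ultrametric. -/
def QUltra {X Q : Type*} (le : Q → Q → Prop) (q₀ : Q) (d : X → X → Q) : Prop :=
  QPseudoUltra le q₀ d ∧ ∀ x y, d x y = q₀ ↔ x = y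

/-- The binary relation `u_Φ` on the range of `Φ`. -/
def uRel {X A : Type*} (Φ : X → X → A) : A → A → Prop :=
  fun y₁ y₂ => ∃ x₁ x₂ x₃, y₁ = Φ x₁ x₃ ∧ y₂ = Φ x₁ x₂ ∧ Φ x₁ x₂ = Φ x₂ x₃

/-- The binary relation `≼_Φ := u_Φᵗ ∪ Δ_{Φ(X²)}`. -/
def lePhi {X A : Type*} (Φ : X → X → A) : A → A → Prop :=
  fun a b => Relation.TransGen (uRel Φ) a b ∨ (a = b ∧ a ∈ rng Φ)

/-- `r` is a partial order on the subset `S`. -/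
def IsPartialOrderOn {A : Type*} (S : Set A) (r : A → A → Prop) : Prop :=
  (∀ a ∈ S, r a a) ∧
  (∀ a b c, a ∈ S → b ∈ S → c ∈ S → r a b → r b c → r a c) ∧
  (∀ a b, a ∈ S → b ∈ S → r a b → r b a → a = b)

/-- `r` is a linear (total) order on the subset `S`. -/
def IsLinearOrderOn {A : Type*} (S : Set A) (r : A → A → Prop) : Prop :=
  IsPartialOrderOn S r ∧ ∀ a b, a ∈ S → b ∈ S → (r a b ∨ r b a)

/-- A (real-valued, nonnegative) pseudometric. -/
def IsPseudoMetric {X : Type*} (d : X → X → ℝ) : Prop :=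
  (∀ x y, 0 ≤ d x y) ∧ (∀ x y, d x y = d y x) ∧ (∀ x, d x x = 0) ∧
  ∀ x y z, d x y ≤ d x z + d z y

/-- A (real-valued) metric. -/
def IsMetric {X : Type*} (d : X → X → ℝ) : Prop :=
  IsPseudoMetric d ∧ ∀ x y, d x y = 0 ↔ x = y

/-- A (real-valued, nonnegative) pseudoultrametric. -/
def IsPseudoUltrametric {X : Type*} (d : X → X → ℝ) : Prop :=
  (∀ x y, 0 ≤ d x y) ∧ (∀ x y, d x y = d y x) ∧ (∀ x, d x x = 0) ∧
  ∀ x y z, d x y ≤ max (d x z) (d z y)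

/-- A (real-valued) ultrametric. -/
def IsUltrametric {X : Type*} (d : X → X → ℝ) : Prop :=
  IsPseudoUltrametric d ∧ ∀ x y, d x y = 0 ↔ x = y

/-- `d` is a `le`-pseudoultrametric, where `le` is a partial order on `Q` having a smallest
element. -/
def IsPseudoUltraFor {X Q : Type*} (d : X → X → Q) (le : Q → Q → Prop) : Prop :=
  IsPartialOrder Q le ∧ ∃ q₀, (∀ q, le q₀ q) ∧ QPseudoUltra le q₀ d

/-- `g : X₁ → X₂` is a weak similarity for the `Q₁`-pseudoultrametric `d₁` and the
`Q₂`-pseudoultrametric `d₂`: `g` is a bijection and there is an order isomorphism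
`f` of the subposet `d₂(X₂²)` of `Q₂` onto the subposet `d₁(X₁²)` of `Q₁` with
`d₁(x, y) = f (d₂ (g x) (g y))`. -/
def WeakSim {X₁ X₂ Q₁ Q₂ : Type*} (le₁ : Q₁ → Q₁ → Prop) (le₂ : Q₂ → Q₂ → Prop)
    (d₁ : X₁ → X₁ → Q₁) (d₂ : X₂ → X₂ → Q₂) (g : X₁ → X₂) : Prop :=
  Function.Bijective g ∧ ∃ f : Q₂ → Q₁,
    Set.BijOn f (rng d₂) (rng d₁) ∧
    (∀ a ∈ rng d₂, ∀ b ∈ rng d₂, (le₂ a b ↔ le₁ (f a) (f b))) ∧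
    ∀ x y, d₁ x y = f (d₂ (g x) (g y))

/-- The subset `S`, ordered by `r`, is order-isomorphic to a subposet of `(ℝ⁺, ≤)`. -/
def EmbedsInRPlus {A : Type*} (S : Set A) (r : A → A → Prop) : Prop :=
  ∃ e : A → ℝ, (∀ a ∈ S, 0 ≤ e a) ∧ Set.InjOn e S ∧
    ∀ a ∈ S, ∀ b ∈ S, (r a b ↔ e a ≤ e b)

universe u v

namespace PermTriple

variable {X Y : Type*}

theorem mono {P P' : X → X → X → Prop} (h : ∀ a b c, P a b c → P' a b c) {x₁ x₂ x₃ : X} :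
    PermTriple P x₁ x₂ x₃ → PermTriple P' x₁ x₂ x₃ :=
  fun ⟨σ, hσ⟩ => ⟨σ, h _ _ _ hσ⟩

theorem map (g : Y → X) {P : X → X → X → Prop} {y₁ y₂ y₃ : Y}
    (h : PermTriple (fun a b c => P (g a) (g b) (g c)) y₁ y₂ y₃) :
    PermTriple P (g y₁) (g y₂) (g y₃) := by
  obtain ⟨σ, hσ⟩ := h
  have key : ∀ i, ![g y₁, g y₂, g y₃] i = g (![y₁, y₂, y₃] i) := by
    intro i
    fin_cases i <;> rfl
  exact ⟨σ, by simpa only [key] using hσ⟩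

theorem cases {P : X → X → X → Prop} {x₁ x₂ x₃ : X} (h : PermTriple P x₁ x₂ x₃) :
    P x₁ x₂ x₃ ∨ P x₁ x₃ x₂ ∨ P x₂ x₁ x₃ ∨ P x₂ x₃ x₁ ∨ P x₃ x₁ x₂ ∨ P x₃ x₂ x₁ := by
  obtain ⟨σ, hσ⟩ := h
  have h01 : σ 0 ≠ σ 1 := σ.injective.ne (by decide)
  have h02 : σ 0 ≠ σ 2 := σ.injective.ne (by decide)
  have h12 : σ 1 ≠ σ 2 := σ.injective.ne (by decide)
  generalize σ 0 = i at *
  generalize σ 1 = j at *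
  generalize σ 2 = k at *
  fin_cases i <;> fin_cases j <;> fin_cases k <;> simp_all

end PermTriple

section

variable {X Y A Q : Type*} {Φ : X → X → A} {le : Q → Q → Prop} {q₀ : Q}

theorem mem_rng (Φ : X → X → A) (x y : X) : Φ x y ∈ rng Φ := ⟨x, y, rfl⟩

theorem mem_rng_of_transGen_left {a b : A} (h : Relation.TransGen (uRel Φ) a b) : a ∈ rng Φ := by
  obtain ⟨c, ⟨x₁, x₂, x₃, rfl, -, -⟩, -⟩ := Relation.TransGen.head'_iff.1 h
  exact mem_rng Φ _ _

theorem mem_rng_of_transGen_right {a b : A} (h : Relation.TransGen (uRel Φ) a b) :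
    b ∈ rng Φ := by
  obtain ⟨c, -, ⟨x₁, x₂, x₃, -, rfl, -⟩⟩ := Relation.TransGen.tail'_iff.1 h
  exact mem_rng Φ _ _

/-- A combinatorial similarity with an ultrametric can be realised on the domain of `Φ` itself. -/
theorem CombSim.exists_injOn_qUltra {d : Y → Y → Q} (h : CombSim Φ d) (hd : QUltra le q₀ d) :
    ∃ f : A → Q, Set.InjOn f (rng Φ) ∧ QUltra le q₀ (fun x y => f (Φ x y)) := by
  obtain ⟨g, ⟨hinj, hsurj⟩, f, hf, hdf⟩ := h
  obtain ⟨⟨hsymm, hdiag, htri⟩, hzero⟩ := hd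
  simp only [hdf] at hsymm hdiag htri hzero
  refine ⟨f, hf.injOn, ⟨?_, ?_, ?_⟩, ?_⟩
  · rw [hsurj.forall₂]
    exact hsymm
  · rw [hsurj.forall]
    exact hdiag
  · rw [hsurj.forall₃]
    exact fun y₁ y₂ y₃ => PermTriple.map g
      (P := fun a b c => le (f (Φ a c)) (f (Φ a b)) ∧ f (Φ a b) = f (Φ b c)) (htri y₁ y₂ y₃)
  · rw [hsurj.forall₂]
    exact fun y₁ y₂ => (hzero y₁ y₂).trans hinj.eq_iff.symm

/-- In a pseudoultrametric space, the base of an isosceles triangle is at most its leg. -/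
theorem QPseudoUltra.le_of_eq (hrefl : ∀ q, le q q) {d : X → X → Q}
    (hd : QPseudoUltra le q₀ d) {x₁ x₂ x₃ : X} (h : d x₁ x₂ = d x₂ x₃) :
    le (d x₁ x₃) (d x₁ x₂) := by
  obtain ⟨hsymm, -, htri⟩ := hd
  have h21 := hsymm x₂ x₁
  have h31 := hsymm x₃ x₁
  have h32 := hsymm x₃ x₂
  have hr := hrefl (d x₁ x₂)
  rcases (htri x₁ x₂ x₃).cases with h' | h' | h' | h' | h' | h' <;> grind

theorem le_of_transGen_uRel [IsPreorder Q le] {f : A → Q}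
    (hd : QPseudoUltra le q₀ (fun x y => f (Φ x y))) {a b : A}
    (h : Relation.TransGen (uRel Φ) a b) : le (f a) (f b) := by
  have step : ∀ {a b}, uRel Φ a b → le (f a) (f b) := by
    rintro _ _ ⟨x₁, x₂, x₃, rfl, rfl, h⟩
    exact hd.le_of_eq (refl_of le) (congrArg f h)
  induction h with
  | single h => exact step h
  | tail _ h ih => exact trans_of le ih (step h)

theorem isPartialOrderOn_lePhi
    (h : ∀ a b, Relation.TransGen (uRel Φ) a b → Relation.TransGen (uRel Φ) b a → a = b) :
    IsPartialOrderOn (rng Φ) (lePhi Φ) := by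
  refine ⟨fun a ha => .inr ⟨rfl, ha⟩, ?_, ?_⟩
  · rintro a b c - - - (hab | ⟨rfl, -⟩) (hbc | ⟨rfl, hb⟩)
    · exact .inl (hab.trans hbc)
    · exact .inl hab
    · exact .inl hbc
    · exact .inr ⟨rfl, hb⟩
  · rintro a b - - (hab | ⟨rfl, -⟩) (hba | ⟨hba, -⟩)
    · exact h a b hab hba
    · exact hba.symm
    · rfl
    · rfl

theorem lePhi_of_eq {x₁ x₂ x₃ : X} (h : Φ x₁ x₂ = Φ x₂ x₃) : lePhi Φ (Φ x₁ x₃) (Φ x₁ x₂) :=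
  .inl (.single ⟨x₁, x₂, x₃, rfl, rfl, h⟩)

end

/-- Corollary 3.19: for a mapping `Φ` with domain `X²`, the following are equivalent:
(i) `Φ` is combinatorially similar to a `Q`-ultrametric for some totally ordered `Q` with
smallest element; (ii) the same for some poset `Q` with smallest element; (iii) `Φ` is
symmetric, `u_Φᵗ` is antisymmetric, `Φ⁻¹(a₀) = Δ_X` for some `a₀` in its range, and every
triple admits an isosceles permutation; (iv) `Φ⁻¹(b₀) = Δ_X`,
`≼_Φ := u_Φᵗ ∪ Δ_{Φ(X²)}` is a partial order on `Φ(X²)` with smallest element `b₀`, and `Φ`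
is a `≼_Φ`-ultrametric. -/
theorem statement8 {X : Type u} {A : Type v} [Nonempty X] (Φ : X → X → A) :
    List.TFAE [
      ∃ (Q : Type v) (leQ : Q → Q → Prop) (q₀ : Q), IsLinearOrder Q leQ ∧ (∀ q, leQ q₀ q) ∧
        ∃ (Y : Type u) (_ : Nonempty Y) (d : Y → Y → Q), QUltra leQ q₀ d ∧ CombSim Φ d,
      ∃ (Q : Type v) (leQ : Q → Q → Prop) (q₀ : Q), IsPartialOrder Q leQ ∧ (∀ q, leQ q₀ q) ∧
        ∃ (Y : Type u) (_ : Nonempty Y) (d : Y → Y → Q), QUltra leQ q₀ d ∧ CombSim Φ d,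
      (∀ x y, Φ x y = Φ y x) ∧
        AntiSymmetric (Relation.TransGen (uRel Φ)) ∧
        (∃ a₀ ∈ rng Φ, ∀ x y, Φ x y = a₀ ↔ x = y) ∧
        (∀ x₁ x₂ x₃ : X, PermTriple (fun a b c => Φ a b = Φ b c) x₁ x₂ x₃),
      ∃ b₀ ∈ rng Φ, (∀ x y, Φ x y = b₀ ↔ x = y) ∧
        IsPartialOrderOn (rng Φ) (lePhi Φ) ∧
        (∀ b ∈ rng Φ, lePhi Φ b₀ b) ∧
        QUltra (lePhi Φ) b₀ Φ ] := by
  tfae_have 1 → 2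
  | ⟨Q, leQ, q₀, hQ, h⟩ => ⟨Q, leQ, q₀, hQ.toIsPartialOrder, h⟩
  tfae_have 2 → 3 := by
    rintro ⟨Q, leQ, q₀, hQ, -, Y, -, d, hd, hsim⟩
    obtain ⟨f, hf, hu⟩ := hsim.exists_injOn_qUltra hd
    have hinj : ∀ x y z w, f (Φ x y) = f (Φ z w) → Φ x y = Φ z w :=
      fun x y z w h => hf (mem_rng Φ x y) (mem_rng Φ z w) h
    refine ⟨fun x y => hinj _ _ _ _ (hu.1.1 x y), fun a b hab hba => ?_, ?_, fun x₁ x₂ x₃ => ?_⟩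
    · exact hf (mem_rng_of_transGen_left hab) (mem_rng_of_transGen_left hba)
        (antisymm_of leQ (le_of_transGen_uRel hu.1 hab) (le_of_transGen_uRel hu.1 hba))
    · obtain ⟨x₀⟩ := ‹Nonempty X›
      refine ⟨Φ x₀ x₀, mem_rng Φ x₀ x₀, fun x y => ?_⟩
      rw [← hu.2 x y, ← hu.1.2.1 x₀]
      exact ⟨congrArg f, hinj _ _ _ _⟩
    · exact (hu.1.2.2 x₁ x₂ x₃).mono fun a b c h => hinj _ _ _ _ h.2
  tfae_have 3 → 4 := by
    rintro ⟨hsymm, hanti, ⟨a₀, ha₀, hdiag⟩, htri⟩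
    refine ⟨a₀, ha₀, hdiag, isPartialOrderOn_lePhi fun a b => @hanti a b, ?_,
      ⟨hsymm, fun x => (hdiag x x).2 rfl, fun x₁ x₂ x₃ => ?_⟩, hdiag⟩
    · rintro _ ⟨x, y, rfl⟩
      have h := lePhi_of_eq (hsymm x y)
      rwa [(hdiag x x).2 rfl] at h
    · exact (htri x₁ x₂ x₃).mono fun a b c h => ⟨lePhi_of_eq h, h⟩
  tfae_have 4 → 1 := by
    classical
    rintro ⟨b₀, hb₀, hdiag, ⟨hrefl, htrans, hanti⟩, hleast, hu⟩
    let r : rng Φ → rng Φ → Prop := fun a b => lePhi Φ a b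
    have : IsPartialOrder (rng Φ) r :=
      { refl := fun a => hrefl a a.2
        trans := fun a b c => htrans a b c a.2 b.2 c.2
        antisymm := fun a b hab hba => Subtype.ext (hanti a b a.2 b.2 hab hba) }
    obtain ⟨s, hs, hrs⟩ := extend_partialOrder r
    let d : X → X → rng Φ := fun x y => ⟨Φ x y, mem_rng Φ x y⟩
    let f : A → rng Φ := fun a => if ha : a ∈ rng Φ then ⟨a, ha⟩ else ⟨b₀, hb₀⟩
    have hf : ∀ x y, f (Φ x y) = d x y := fun x y => dif_pos (mem_rng Φ x y)
    refine ⟨rng Φ, s, ⟨b₀, hb₀⟩, hs, fun q => hrs _ _ (hleast q q.2), X, ‹_›, d,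
      ⟨⟨fun x y => Subtype.ext (hu.1.1 x y), fun x => Subtype.ext (hu.1.2.1 x), fun x₁ x₂ x₃ =>
        (hu.1.2.2 x₁ x₂ x₃).mono fun a b c h => ⟨hrs _ _ h.1, Subtype.ext h.2⟩⟩,
        fun x y => Subtype.ext_iff.trans (hdiag x y)⟩,
      id, Function.bijective_id, f, ⟨?_, ?_, ?_⟩, fun x y => (hf x y).symm⟩
    · rintro _ ⟨x, y, rfl⟩
      exact ⟨x, y, (hf x y).symm⟩
    · rintro _ ⟨x, y, rfl⟩ _ ⟨z, w, rfl⟩ h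
      rw [hf, hf] at h
      exact congrArg Subtype.val h
    · rintro _ ⟨x, y, rfl⟩
      exact ⟨Φ x y, mem_rng Φ x y, hf x y⟩
  tfae_finish

end CombSimPaper
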